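/- Let n ≥ 2 and consider the set E = V_n \ V_{n−1} with conductances c^n computed at level n. For i ∈ {0,1,2} (indices mod 3) let x_i = (q_{i−1} + q_{i+1})/2 ∈ V₁ \ V₀ and let D^i_n = { y ∈ V_n : y ∼_n x_i } be its set of four n-neighbors (which lie in V_n \ V_{n−1}). Then for distinct a, b ∈ D^i_n: if a ∼_n b then c^n_{a,b} = (5/4)·(5/3)^n, and if the graph distance between a and b in Γ_n equals 2 then c^n_{a,b} = (1/4)·(5/3)^n. -/

import Mathlib

open scoped BigOperators

noncomputable section

namespace SGPaper

/-- The three corners of the Sierpinski gasket: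
`q₀ = (1/2, √3/2)`, `q₁ = (0,0)`, `q₂ = (1,0)`. -/
def q : Fin 3 → ℝ × ℝ
  | 0 => (1 / 2, Real.sqrt 3 / 2)
  | 1 => (0, 0)
  | 2 => (1, 0)

/-- The contraction map towards corner `i`: `F_i(x) = (x + q_i)/2`. -/
def Fmap (i : Fin 3) (x : ℝ × ℝ) : ℝ × ℝ := (2⁻¹ : ℝ) • (x + q i)

/-- `Fword w = F_{w₁} ∘ ⋯ ∘ F_{w_m}` for the word `w = w₁⋯w_m`. -/
def Fword (w : List (Fin 3)) : ℝ × ℝ → ℝ × ℝ :=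
  w.foldr (fun i f => Fmap i ∘ f) id

/-- The level-`m` vertex set of the Sierpinski gasket:
`V_m = ⋃_{|w| = m} F_w({q₀, q₁, q₂})`. -/
def V (m : ℕ) : Set (ℝ × ℝ) :=
  {x | ∃ w : List (Fin 3), w.length = m ∧ ∃ i : Fin 3, x = Fword w (q i)}

/-- `x` and `y` are `m`-neighbors: they are distinct and belong to a common
level-`m` cell `F_w({q₀, q₁, q₂})`. -/
def Nbr (m : ℕ) (x y : ℝ × ℝ) : Prop :=
  x ≠ y ∧ ∃ w : List (Fin 3), w.length = m ∧
    (∃ i : Fin 3, x = Fword w (q i)) ∧ (∃ j : Fin 3, y = Fword w (q j))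

/-- The value `(u x - u y)²` on the unordered pair `{x, y}`. -/
def edgeVal (u : ℝ × ℝ → ℝ) : Sym2 (ℝ × ℝ) → ℝ :=
  Sym2.lift ⟨fun x y => (u x - u y) ^ 2, fun _ _ => by ring⟩

/-- The unordered pair `e` is an edge of the level-`m` graph `Γ_m`. -/
def IsEdge (m : ℕ) (e : Sym2 (ℝ × ℝ)) : Prop :=
  ∃ x y : ℝ × ℝ, Nbr m x y ∧ e = s(x, y)

/-- The level-`m` graph energy: `E_m(u) = (5/3)^m Σ (u x − u y)²`, the sum being over
unordered `m`-neighbor pairs `{x, y}` (a finite set, so `tsum` is the honest sum). -/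
def Energy (m : ℕ) (u : ℝ × ℝ → ℝ) : ℝ :=
  (5 / 3 : ℝ) ^ m * ∑' e : {e : Sym2 (ℝ × ℝ) // IsEdge m e}, edgeVal u e

/-- `Q_E(v)`: minimal level-`m` energy among functions `u : V_m → ℝ` agreeing
with `v` on `E` (the minimum is attained, so it equals this infimum). -/
def Q (m : ℕ) (E : Set (ℝ × ℝ)) (v : ℝ × ℝ → ℝ) : ℝ :=
  sInf {r | ∃ u : ℝ × ℝ → ℝ, (∀ x ∈ E, u x = v x) ∧ r = Energy m u}

/-- Indicator function of the point `z`. -/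
def ind (z : ℝ × ℝ) : ℝ × ℝ → ℝ := fun t => if t = z then 1 else 0

/-- The conductance `c^E_{x,y} = (Q_E(𝟙_x) + Q_E(𝟙_y) − Q_E(𝟙_x + 𝟙_y))/2`
between `x, y ∈ E`, computed at level `m`. -/
def cond (m : ℕ) (E : Set (ℝ × ℝ)) (x y : ℝ × ℝ) : ℝ :=
  (Q m E (ind x) + Q m E (ind y) - Q m E (ind x + ind y)) / 2

/-- `x_i = (q_{i−1} + q_{i+1})/2`, the midpoint opposite `q_i` (element of `V₁ \ V₀`). -/
def xmid (i : Fin 3) : ℝ × ℝ := (2⁻¹ : ℝ) • (q (i - 1) + q (i + 1))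

/-- `D^i_n`: the set of `n`-neighbors in `V_n` of the midpoint `x_i`. -/
def Dset (n : ℕ) (i : Fin 3) : Set (ℝ × ℝ) := {y | y ∈ V n ∧ Nbr n y (xmid i)}


/-! ### Lattice coordinates -/

/-- The point `s q₀ + t q₂` -/
def lat (s t : ℝ) : ℝ × ℝ := (s / 2 + t, s * (Real.sqrt 3 / 2))

lemma lat_inj {s t s' t' : ℝ} (h : lat s t = lat s' t') : s = s' ∧ t = t' := by
  have h3 : Real.sqrt 3 / 2 ≠ 0 := by positivity
  simp only [lat, Prod.mk.injEq] at h
  obtain ⟨h1, h2⟩ := h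
  have := mul_right_cancel₀ h3 h2
  subst this
  exact ⟨rfl, by linarith⟩

lemma lat_add (s t s' t' : ℝ) : lat s t + lat s' t' = lat (s + s') (t + t') := by
  simp only [lat, Prod.mk_add_mk, Prod.mk.injEq]; constructor <;> ring

lemma lat_smul (c s t : ℝ) : c • lat s t = lat (c * s) (c * t) := by
  simp only [lat, Prod.smul_mk, smul_eq_mul, Prod.mk.injEq]; constructor <;> ring

def al : Fin 3 → ℤ := ![1, 0, 0]
def be : Fin 3 → ℤ := ![0, 0, 1]

lemma q_lat (i : Fin 3) : q i = lat (al i) (be i) := by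
  fin_cases i <;> simp [q, lat, al, be]

lemma Fword_cons (i : Fin 3) (w : List (Fin 3)) (x : ℝ × ℝ) :
    Fword (i :: w) x = Fmap i (Fword w x) := rfl

lemma Fword_append (w v : List (Fin 3)) (x : ℝ × ℝ) :
    Fword (w ++ v) x = Fword w (Fword v x) := by
  induction w with
  | nil => rfl
  | cons i w ih => rw [List.cons_append, Fword_cons, ih, Fword_cons]

lemma Fword_affine (w : List (Fin 3)) : ∃ s t : ℤ, ∀ x y : ℝ,
    Fword w (lat x y) = lat ((2⁻¹ : ℝ) ^ w.length * (x + s)) ((2⁻¹ : ℝ) ^ w.length * (y + t)) := by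
  induction w with
  | nil => exact ⟨0, 0, fun x y => by simp [Fword]⟩
  | cons i w ih =>
    obtain ⟨s, t, h⟩ := ih
    refine ⟨s + 2 ^ w.length * al i, t + 2 ^ w.length * be i, fun x y => ?_⟩
    rw [Fword_cons, h, Fmap, q_lat, lat_add, lat_smul, List.length_cons]
    have : (2⁻¹ : ℝ) ^ w.length * 2 ^ w.length = 1 := by
      rw [← mul_pow]; norm_num
    push_cast
    congr 1
    · rw [pow_succ]; linear_combination (-(2⁻¹ : ℝ) * al i) * this
    · rw [pow_succ]; linear_combination (-(2⁻¹ : ℝ) * be i) * this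

lemma Fmap_q (i : Fin 3) : Fmap i (q i) = q i := by
  rw [Fmap, q_lat, lat_add, lat_smul]; congr 1 <;> ring

lemma Fword_snoc (w : List (Fin 3)) (i : Fin 3) : Fword (w ++ [i]) (q i) = Fword w (q i) := by
  rw [Fword_append]; congr 1; exact Fmap_q i

lemma V_succ {m : ℕ} {x : ℝ × ℝ} (h : x ∈ V m) : x ∈ V (m + 1) := by
  obtain ⟨w, hw, i, rfl⟩ := h
  exact ⟨w ++ [i], by simp [hw], i, (Fword_snoc w i).symm⟩

lemma V_coord {m : ℕ} {x : ℝ × ℝ} (h : x ∈ V m) :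
    ∃ s t : ℤ, x = lat ((2⁻¹ : ℝ) ^ m * s) ((2⁻¹ : ℝ) ^ m * t) := by
  obtain ⟨w, hw, i, rfl⟩ := h
  obtain ⟨s, t, hst⟩ := Fword_affine w
  refine ⟨al i + s, be i + t, ?_⟩
  rw [q_lat, hst, hw]; push_cast; rfl

/-- Differences of `V m` points measured at scale `m+1` are even. -/
lemma V_even {m : ℕ} {x y : ℝ × ℝ} (hx : x ∈ V m) (hy : y ∈ V m) {s t : ℤ}
    (h : y = x + lat ((2⁻¹ : ℝ) ^ (m + 1) * s) ((2⁻¹ : ℝ) ^ (m + 1) * t)) :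
    Even s ∧ Even t := by
  obtain ⟨a, b, rfl⟩ := V_coord hx
  obtain ⟨c, d, rfl⟩ := V_coord hy
  rw [lat_add] at h
  obtain ⟨h1, h2⟩ := lat_inj h
  have hp : (2⁻¹ : ℝ) ^ (m + 1) ≠ 0 := by positivity
  have e : (2⁻¹ : ℝ) ^ m = (2⁻¹ : ℝ) ^ (m + 1) * 2 := by rw [pow_succ]; ring
  rw [e, mul_assoc, mul_assoc, ← mul_add] at h1 h2
  have h1 := mul_left_cancel₀ hp h1
  have h2 := mul_left_cancel₀ hp h2
  have h1 : 2 * c = 2 * a + s := by exact_mod_cast h1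
  have h2 : 2 * d = 2 * b + t := by exact_mod_cast h2
  exact ⟨⟨c - a, by omega⟩, ⟨d - b, by omega⟩⟩

lemma Fword_diff {m : ℕ} {w : List (Fin 3)} (hw : w.length = m) (k l : Fin 3) :
    Fword w (q l) = Fword w (q k) + lat ((2⁻¹ : ℝ) ^ m * ((al l - al k : ℤ) : ℝ))
      ((2⁻¹ : ℝ) ^ m * ((be l - be k : ℤ) : ℝ)) := by
  obtain ⟨s, t, hst⟩ := Fword_affine w
  rw [q_lat, q_lat, hst, hst, lat_add, hw]
  push_cast
  congr 1 <;> ring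

lemma Nbr.symm' {m : ℕ} {x y : ℝ × ℝ} (h : Nbr m x y) : Nbr m y x := by
  obtain ⟨h1, w, hw, h2, h3⟩ := h
  exact ⟨h1.symm, w, hw, h3, h2⟩

lemma Nbr_diff {m : ℕ} {x y : ℝ × ℝ} (h : Nbr m x y) : ∃ k l : Fin 3, k ≠ l ∧
    y = x + lat ((2⁻¹ : ℝ) ^ m * ((al l - al k : ℤ) : ℝ))
      ((2⁻¹ : ℝ) ^ m * ((be l - be k : ℤ) : ℝ)) := by
  obtain ⟨h1, w, hw, ⟨k, rfl⟩, ⟨l, rfl⟩⟩ := h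
  exact ⟨k, l, fun h => h1 (by rw [h]), Fword_diff hw k l⟩

lemma Nbr_V_left {m : ℕ} {x y : ℝ × ℝ} (h : Nbr m x y) : x ∈ V m := by
  obtain ⟨h1, w, hw, ⟨k, rfl⟩, ⟨l, rfl⟩⟩ := h
  exact ⟨w, hw, k, rfl⟩

lemma root_odd : ∀ k l : Fin 3, k ≠ l → ¬ (Even (al l - al k) ∧ Even (be l - be k)) := by
  decide

lemma root_sum : ∀ k l k' l' : Fin 3, k ≠ l → k' ≠ l' →
    Even ((al l - al k) + (al l' - al k')) → Even ((be l - be k) + (be l' - be k')) →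
    ((al l - al k) + (al l' - al k') = 0 ∧ (be l - be k) + (be l' - be k') = 0) ∨
    ((al l' - al k') = al l - al k ∧ (be l' - be k') = be l - be k) := by
  decide

/-- neighbours of a `V m` point at level `m+1` are not in `V m` -/
lemma Nbr_not_V {m : ℕ} {x y : ℝ × ℝ} (hx : x ∈ V m) (h : Nbr (m + 1) x y) : y ∉ V m := by
  intro hy
  obtain ⟨k, l, hkl, e⟩ := Nbr_diff h
  exact root_odd k l hkl (V_even hx hy e)

lemma Fword_inj {w : List (Fin 3)} {k l : Fin 3} (h : Fword w (q k) = Fword w (q l)) : k = l := by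
  obtain ⟨s, t, hst⟩ := Fword_affine w
  rw [q_lat, q_lat, hst, hst] at h
  obtain ⟨h1, h2⟩ := lat_inj h
  have hp : (2⁻¹ : ℝ) ^ w.length ≠ 0 := by positivity
  have h1 := mul_left_cancel₀ hp h1
  have h2 := mul_left_cancel₀ hp h2
  have h1 : al k = al l := by exact_mod_cast add_right_cancel h1
  have h2 : be k = be l := by exact_mod_cast add_right_cancel h2
  have key : ∀ k l : Fin 3, al k = al l → be k = be l → k = l := by decide
  exact key k l h1 h2

/-- Two steps from a `V m` point back to a `V m` point. -/
lemma two_step {m : ℕ} {x a y : ℝ × ℝ} (hx : x ∈ V m) (hy : y ∈ V m)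
    (h : Nbr (m + 1) x a) (h' : Nbr (m + 1) a y) : y = x ∨ y - a = a - x := by
  obtain ⟨k, l, hkl, e⟩ := Nbr_diff h
  obtain ⟨k', l', hkl', e'⟩ := Nbr_diff h'
  have e2 : y = x + lat ((2⁻¹ : ℝ) ^ (m + 1) * (((al l - al k) + (al l' - al k') : ℤ) : ℝ))
      ((2⁻¹ : ℝ) ^ (m + 1) * (((be l - be k) + (be l' - be k') : ℤ) : ℝ)) := by
    rw [e', e, add_assoc, lat_add, ← mul_add, ← mul_add]
    push_cast
    rfl
  obtain ⟨h1, h2⟩ := V_even hx hy e2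
  rcases root_sum k l k' l' hkl hkl' h1 h2 with ⟨h3, h4⟩ | ⟨h3, h4⟩
  · left
    rw [e2, h3, h4]; simp [lat]
  · right
    rw [h3, h4] at e'
    rw [e', add_sub_cancel_left, e, add_sub_cancel_left]

lemma common_nbr {m : ℕ} {x a b y : ℝ × ℝ} (hx : x ∈ V m) (hy : y ∈ V m) (hab : a ≠ b)
    (ha : Nbr (m + 1) x a) (hb : Nbr (m + 1) x b) (ha' : Nbr (m + 1) a y)
    (hb' : Nbr (m + 1) b y) : y = x := by
  rcases two_step hx hy ha ha' with h | h
  · exact h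
  rcases two_step hx hy hb hb' with h' | h'
  · exact h'
  exfalso; apply hab
  have h1 : (2 : ℝ) • a = y + x := by rw [two_smul]; linear_combination -h
  have h2 : (2 : ℝ) • b = y + x := by rw [two_smul]; linear_combination -h'
  exact smul_right_injective _ (two_ne_zero' ℝ) (h1.trans h2.symm)

/-! ### Neighbours of the midpoints -/

lemma Fword_replicate (m : ℕ) (k : Fin 3) : Fword (List.replicate m k) (q k) = q k := by
  induction m with
  | zero => rfl
  | succ m ih => rw [List.replicate_succ, Fword_cons, ih, Fmap_q]

lemma Fmap_comm (j k : Fin 3) : Fmap j (q k) = Fmap k (q j) := by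
  rw [Fmap, Fmap, add_comm]

lemma xmid_eq (i : Fin 3) : xmid i = Fmap (i + 1) (q (i - 1)) := rfl

lemma xmid_V (i : Fin 3) (m : ℕ) : xmid i ∈ V (m + 1) :=
  ⟨(i + 1) :: List.replicate m (i - 1), by simp, i - 1, by
    rw [Fword_cons, Fword_replicate]; rfl⟩

lemma xmid_cell {i l : Fin 3} : ∀ {m : ℕ} {w : List (Fin 3)}, w.length = m + 1 →
    xmid i = Fword w (q l) →
    (l = i - 1 ∧ w = (i + 1) :: List.replicate m (i - 1)) ∨
    (l = i + 1 ∧ w = (i - 1) :: List.replicate m (i + 1)) := by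
  intro m
  induction m with
  | zero =>
    intro w hw h
    obtain ⟨c, rfl⟩ := List.length_eq_one_iff.1 hw
    have h : (2⁻¹ : ℝ) • (q (i - 1) + q (i + 1)) = (2⁻¹ : ℝ) • (q l + q c) := h
    have h := smul_right_injective _ (show (2⁻¹ : ℝ) ≠ 0 by norm_num) h
    simp only [q_lat, lat_add] at h
    obtain ⟨h1, h2⟩ := lat_inj h
    have h1 : al (i - 1) + al (i + 1) = al l + al c := by exact_mod_cast h1
    have h2 : be (i - 1) + be (i + 1) = be l + be c := by exact_mod_cast h2
    have key : ∀ i l c : Fin 3, al (i - 1) + al (i + 1) = al l + al c →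
      be (i - 1) + be (i + 1) = be l + be c →
      (l = i - 1 ∧ c = i + 1) ∨ (l = i + 1 ∧ c = i - 1) := by decide
    rcases key i l c h1 h2 with ⟨rfl, rfl⟩ | ⟨rfl, rfl⟩ <;> simp
  | succ m ih =>
    intro w hw h
    have hne : w ≠ [] := by rintro rfl; simp at hw
    obtain ⟨w', c, rfl⟩ : ∃ w' c, w = w' ++ [c] :=
      ⟨w.dropLast, w.getLast hne, (List.dropLast_append_getLast hne).symm⟩
    have hw' : w'.length = m + 1 := by simpa using hw
    have hlc : l = c := by
      by_contra hlc
      have hc : Fword (w' ++ [c]) (q c) ∈ V (m + 1) := ⟨w', hw', c, Fword_snoc w' c⟩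
      refine Nbr_not_V (xmid_V i m) ⟨?_, w' ++ [c], hw, ⟨l, h⟩, ⟨c, rfl⟩⟩ hc
      rw [h]
      exact fun e => hlc (Fword_inj e)
    subst hlc
    rw [Fword_snoc] at h
    rcases ih hw' h with ⟨h1, h2⟩ | ⟨h1, h2⟩
    · left; refine ⟨h1, ?_⟩
      rw [h2, h1, List.replicate_succ']; rfl
    · right; refine ⟨h1, ?_⟩
      rw [h2, h1, List.replicate_succ']; rfl

/-- Translate of a point by a root at scale `m`. -/
def shift (m : ℕ) (x : ℝ × ℝ) (p : Fin 3 × Fin 3) : ℝ × ℝ :=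
  x + lat ((2⁻¹ : ℝ) ^ m * ((al p.2 - al p.1 : ℤ) : ℝ))
      ((2⁻¹ : ℝ) ^ m * ((be p.2 - be p.1 : ℤ) : ℝ))

lemma shift_inj (m : ℕ) (x : ℝ × ℝ) (p p' : Fin 3 × Fin 3) (hp : p.1 ≠ p.2)
    (h : shift m x p = shift m x p') : p = p' := by
  have h := add_left_cancel h
  obtain ⟨h1, h2⟩ := lat_inj h
  have hp0 : (2⁻¹ : ℝ) ^ m ≠ 0 := by positivity
  have h1 := mul_left_cancel₀ hp0 h1
  have h2 := mul_left_cancel₀ hp0 h2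
  have h1 : al p.2 - al p.1 = al p'.2 - al p'.1 := by exact_mod_cast h1
  have h2 : be p.2 - be p.1 = be p'.2 - be p'.1 := by exact_mod_cast h2
  have key : ∀ a b c d : Fin 3, a ≠ b → al b - al a = al d - al c →
      be b - be a = be d - be c → a = c ∧ b = d := by decide
  obtain ⟨e1, e2⟩ := key _ _ _ _ hp h1 h2
  exact Prod.ext e1 e2

lemma xmid_nbr_iff (i : Fin 3) (m : ℕ) (y : ℝ × ℝ) : Nbr (m + 1) (xmid i) y ↔
    ∃ p : Fin 3 × Fin 3, (p.1 ≠ p.2 ∧ p.1 ≠ i) ∧ shift (m + 1) (xmid i) p = y := by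
  constructor
  · rintro ⟨h1, w, hw, ⟨k, hk⟩, ⟨l, rfl⟩⟩
    refine ⟨(k, l), ⟨?_, ?_⟩, ?_⟩
    · rintro h
      simp only at h
      exact h1 (by rw [hk, h])
    · have key : ∀ i : Fin 3, i - 1 ≠ i ∧ i + 1 ≠ i := by decide
      rcases xmid_cell hw hk with ⟨h, -⟩ | ⟨h, -⟩
      · simpa only [h] using (key i).1
      · simpa only [h] using (key i).2
    · rw [Fword_diff hw k l, ← hk]; rfl
  · rintro ⟨⟨k, l⟩, ⟨h1, h2⟩, rfl⟩
    simp only at h1 h2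
    have key : ∀ i k : Fin 3, k ≠ i → k = i - 1 ∨ k = i + 1 := by decide
    obtain ⟨w, hw, e⟩ : ∃ w : List (Fin 3), w.length = m + 1 ∧ xmid i = Fword w (q k) := by
      rcases key i k h2 with rfl | rfl
      · exact ⟨(i + 1) :: List.replicate m (i - 1), by simp, by
          rw [Fword_cons, Fword_replicate]; rfl⟩
      · exact ⟨(i - 1) :: List.replicate m (i + 1), by simp, by
          rw [Fword_cons, Fword_replicate, Fmap_comm]; rfl⟩
    have e2 : shift (m + 1) (xmid i) (k, l) = Fword w (q l) := by
      rw [Fword_diff hw k l, ← e]; rfl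
    rw [e2]
    refine ⟨?_, w, hw, ⟨k, e⟩, ⟨l, rfl⟩⟩
    rw [e]
    exact fun h => h1 (Fword_inj h)

/-! ### Finiteness and energy -/

lemma V_finite (m : ℕ) : (V m).Finite := by
  have : V m ⊆ ⋃ i : Fin 3, (fun w => Fword w (q i)) '' {w : List (Fin 3) | w.length = m} := by
    rintro x ⟨w, hw, i, rfl⟩
    exact Set.mem_iUnion.2 ⟨i, w, hw, rfl⟩
  exact (Set.finite_iUnion fun i => (List.finite_length_eq (Fin 3) m).image _).subset this

def Vf (m : ℕ) : Finset (ℝ × ℝ) := (V_finite m).toFinset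

lemma mem_Vf {m : ℕ} {x : ℝ × ℝ} : x ∈ Vf m ↔ x ∈ V m := Set.Finite.mem_toFinset _

open Classical in
def nb (m : ℕ) (x : ℝ × ℝ) : Finset (ℝ × ℝ) := (Vf m).filter (Nbr m x)

lemma mem_nb {m : ℕ} {x y : ℝ × ℝ} : y ∈ nb m x ↔ Nbr m x y := by
  classical
  simp only [nb, Finset.mem_filter, mem_Vf, and_iff_right_iff_imp]
  exact fun h => Nbr_V_left h.symm'

lemma nb_xmid_card (i : Fin 3) (m : ℕ) : (nb (m + 1) (xmid i)).card = 4 := by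
  classical
  have : nb (m + 1) (xmid i) =
      (Finset.univ.filter fun p : Fin 3 × Fin 3 => p.1 ≠ p.2 ∧ p.1 ≠ i).image
        (shift (m + 1) (xmid i)) := by
    ext y
    rw [mem_nb, xmid_nbr_iff]
    simp only [Finset.mem_image, Finset.mem_filter, Finset.mem_univ, true_and]
  rw [this, Finset.card_image_of_injOn]
  · clear this; revert i; decide
  · intro p hp p' _ h
    simp only [Finset.coe_filter, Finset.mem_univ, true_and, Set.mem_ofPred_eq] at hp
    exact shift_inj _ _ _ _ hp.1 h

/-- The bilinear form as a sum over ordered pairs. -/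
def Bf (m : ℕ) (u h : ℝ × ℝ → ℝ) : ℝ :=
  ∑ x ∈ Vf m, ∑ y ∈ nb m x, (u x - u y) * (h x - h y)

lemma sum_swap (m : ℕ) (f : ℝ × ℝ → ℝ × ℝ → ℝ) :
    ∑ x ∈ Vf m, ∑ y ∈ nb m x, f x y = ∑ x ∈ Vf m, ∑ y ∈ nb m x, f y x := by
  apply Finset.sum_comm'
  intro x y
  rw [mem_nb, mem_nb, mem_Vf, mem_Vf]
  exact ⟨fun h => ⟨h.2.symm', Nbr_V_left h.2.symm'⟩, fun h => ⟨Nbr_V_left h.1.symm', h.1.symm'⟩⟩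

lemma Bf_parts (m : ℕ) (u h : ℝ × ℝ → ℝ) :
    Bf m u h = 2 * ∑ x ∈ Vf m, h x * ∑ y ∈ nb m x, (u x - u y) := by
  have e : Bf m u h = (∑ x ∈ Vf m, ∑ y ∈ nb m x, (u x - u y) * h x) +
      ∑ x ∈ Vf m, ∑ y ∈ nb m x, (u y - u x) * h y := by
    rw [Bf, ← Finset.sum_add_distrib]
    refine Finset.sum_congr rfl fun x _ => ?_
    rw [← Finset.sum_add_distrib]
    exact Finset.sum_congr rfl fun y _ => by ring
  rw [e, sum_swap m fun x y => (u y - u x) * h y, two_mul]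
  congr 1 <;>
  · refine Finset.sum_congr rfl fun x _ => ?_
    rw [Finset.mul_sum]
    exact Finset.sum_congr rfl fun y _ => by ring

lemma Bf_add (m : ℕ) (u h : ℝ × ℝ → ℝ) :
    Bf m (u + h) (u + h) = Bf m u u + 2 * Bf m u h + Bf m h h := by
  simp only [Bf, Finset.mul_sum, ← Finset.sum_add_distrib]
  refine Finset.sum_congr rfl fun x _ => Finset.sum_congr rfl fun y _ => ?_
  simp only [Pi.add_apply]; ring

lemma Bf_nonneg (m : ℕ) (u : ℝ × ℝ → ℝ) : 0 ≤ Bf m u u :=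
  Finset.sum_nonneg fun _ _ => Finset.sum_nonneg fun _ _ => mul_self_nonneg _

lemma Energy_eq (m : ℕ) (u : ℝ × ℝ → ℝ) : Energy m u = (5 / 3 : ℝ) ^ m * (Bf m u u / 2) := by
  classical
  let P : Finset ((ℝ × ℝ) × (ℝ × ℝ)) := (Vf m ×ˢ Vf m).filter fun p => Nbr m p.1 p.2
  have hP : ∀ p, p ∈ P ↔ Nbr m p.1 p.2 := by
    intro p
    simp only [P, Finset.mem_filter, Finset.mem_product, mem_Vf, and_iff_right_iff_imp]
    exact fun h => ⟨Nbr_V_left h, Nbr_V_left h.symm'⟩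
  let g : (ℝ × ℝ) × (ℝ × ℝ) → Sym2 (ℝ × ℝ) := fun p => s(p.1, p.2)
  let S := P.image g
  have hS : ∀ e, e ∈ S ↔ IsEdge m e := by
    intro e
    simp only [S, Finset.mem_image, hP, IsEdge, g]
    exact ⟨fun ⟨p, h, e⟩ => ⟨p.1, p.2, h, e.symm⟩, fun ⟨x, y, h, e⟩ => ⟨(x, y), h, e.symm⟩⟩
  have h1 : ∑' e : {e : Sym2 (ℝ × ℝ) // IsEdge m e}, edgeVal u e = ∑ e ∈ S, edgeVal u e := by
    rw [← Finset.tsum_subtype S (edgeVal u)]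
    exact Equiv.tsum_eq (Equiv.subtypeEquivRight fun e => (hS e).symm)
      (fun e : {e // e ∈ S} => edgeVal u e)
  have h2 : Bf m u u = ∑ p ∈ P, edgeVal u (g p) := by
    rw [Finset.sum_filter, Finset.sum_product, Bf]
    refine Finset.sum_congr rfl fun x _ => ?_
    rw [nb, Finset.sum_filter]
    refine Finset.sum_congr rfl fun y _ => ?_
    simp only [g, edgeVal, Sym2.lift_mk, sq]
  have h3 : ∑ p ∈ P, edgeVal u (g p) = ∑ e ∈ S, 2 * edgeVal u e := by
    rw [← Finset.sum_fiberwise_of_maps_to (t := S) (g := g)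
      fun p hp => Finset.mem_image_of_mem g hp]
    refine Finset.sum_congr rfl fun e he => ?_
    obtain ⟨⟨x, y⟩, hxy, rfl⟩ := Finset.mem_image.1 he
    have hN : Nbr m x y := (hP _).1 hxy
    have : P.filter (fun p => g p = g (x, y)) = {(x, y), (y, x)} := by
      ext ⟨a, b⟩
      simp only [Finset.mem_filter, hP, g, Sym2.eq_iff, Finset.mem_insert, Finset.mem_singleton,
        Prod.mk.injEq]
      constructor
      · exact fun h => h.2
      · rintro (⟨rfl, rfl⟩ | ⟨rfl, rfl⟩)
        · exact ⟨hN, Or.inl ⟨rfl, rfl⟩⟩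
        · exact ⟨hN.symm', Or.inr ⟨rfl, rfl⟩⟩
    rw [this, Finset.sum_pair]
    · have : g (y, x) = g (x, y) := Sym2.eq_swap
      rw [this, two_mul]
    · intro h
      exact hN.1 (Prod.mk.inj h).1
  rw [Energy, h1, h2, h3, ← Finset.mul_sum]
  ring

/-- Harmonic extensions realise the trace form. -/
lemma Q_eq (m : ℕ) (E : Set (ℝ × ℝ)) (v u : ℝ × ℝ → ℝ) (hu : ∀ x ∈ E, u x = v x)
    (hh : ∀ x ∈ V m, x ∉ E → ∑ y ∈ nb m x, (u x - u y) = 0) :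
    Q m E v = (5 / 3 : ℝ) ^ m * (Bf m u u / 2) := by
  rw [← Energy_eq]
  apply IsLeast.csInf_eq
  refine ⟨⟨u, hu, rfl⟩, ?_⟩
  rintro r ⟨u', hu', rfl⟩
  obtain ⟨h, rfl⟩ : ∃ h, u' = u + h := ⟨u' - u, by simp⟩
  have h0 : Bf m u h = 0 := by
    rw [Bf_parts, Finset.sum_eq_zero, mul_zero]
    intro x hx
    by_cases hxE : x ∈ E
    · have h1 := hu' x hxE
      rw [Pi.add_apply, hu x hxE] at h1
      rw [show h x = 0 by linarith, zero_mul]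
    · rw [hh x (mem_Vf.1 hx) hxE, mul_zero]
  rw [Energy_eq, Energy_eq, Bf_add, h0]
  have := Bf_nonneg m h
  gcongr
  linarith

open Classical in
/-- The harmonic extension of the indicator of `a`. -/
def harmExt (m : ℕ) (a : ℝ × ℝ) : ℝ × ℝ → ℝ := fun x =>
  if x ∈ V m then (if Nbr (m + 1) x a then ((nb (m + 1) x).card : ℝ)⁻¹ else 0) else ind a x

lemma harmExt_harm (m : ℕ) (a x : ℝ × ℝ) (hx : x ∈ V m) :
    ∑ y ∈ nb (m + 1) x, (harmExt m a x - harmExt m a y) = 0 := by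
  classical
  have h1 : ∀ y ∈ nb (m + 1) x, harmExt m a y = if y = a then 1 else 0 := by
    intro y hy
    rw [harmExt, if_neg (Nbr_not_V hx (mem_nb.1 hy))]; rfl
  rw [Finset.sum_sub_distrib, Finset.sum_congr rfl h1, Finset.sum_ite_eq', Finset.sum_const,
    nsmul_eq_mul, harmExt, if_pos hx]
  by_cases h : Nbr (m + 1) x a
  · have hm := mem_nb.2 h
    have : ((nb (m + 1) x).card : ℝ) ≠ 0 := by
      exact_mod_cast (Finset.card_pos.2 ⟨a, hm⟩).ne'
    rw [if_pos h, if_pos hm, mul_inv_cancel₀ this, sub_self]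
  · rw [if_neg h, if_neg (fun h' => h (mem_nb.1 h'))]; simp

lemma cond_eq (m : ℕ) (a b : ℝ × ℝ) (ha : a ∉ V m) (hb : b ∉ V m) (hbV : b ∈ V (m + 1))
    (hab : a ≠ b) : cond (m + 1) (V (m + 1) \ V m) a b =
      (5 / 3 : ℝ) ^ (m + 1) * ∑ y ∈ nb (m + 1) b, harmExt m a y := by
  classical
  have hE : ∀ a, ∀ x ∈ V (m + 1) \ V m, harmExt m a x = ind a x := by
    intro a x hx
    rw [harmExt, if_neg hx.2]
  have hmem : ∀ x, x ∈ V (m + 1) → x ∉ V (m + 1) \ V m → x ∈ V m := by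
    intro x h1 h2
    by_contra h3
    exact h2 ⟨h1, h3⟩
  rw [cond, Q_eq _ _ (ind a) (harmExt m a) (hE a) fun x h1 h2 => harmExt_harm m a x (hmem x h1 h2),
    Q_eq _ _ (ind b) (harmExt m b) (hE b) fun x h1 h2 => harmExt_harm m b x (hmem x h1 h2),
    Q_eq _ _ (ind a + ind b) (harmExt m a + harmExt m b), Bf_add, Bf_parts _ (harmExt m a) (harmExt m b)]
  · rw [Finset.sum_eq_single b]
    · have e1 : harmExt m b b = 1 := by rw [harmExt, if_neg hb, ind, if_pos rfl]
      have e2 : harmExt m a b = 0 := by rw [harmExt, if_neg hb, ind, if_neg hab.symm]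
      rw [e1, e2]
      simp only [zero_sub, Finset.sum_neg_distrib]
      ring
    · intro x hx hxb
      by_cases h : x ∈ V m
      · rw [harmExt_harm m a x h, mul_zero]
      · rw [harmExt, if_neg h, ind, if_neg hxb, zero_mul]
    · intro h
      exact absurd (mem_Vf.2 hbV) h
  · intro x hx
    rw [Pi.add_apply, Pi.add_apply, hE a x hx, hE b x hx]
  · intro x h1 h2
    have ea := harmExt_harm m a x (hmem x h1 h2)
    have eb := harmExt_harm m b x (hmem x h1 h2)
    calc _ = ∑ y ∈ nb (m + 1) x, ((harmExt m a x - harmExt m a y) + (harmExt m b x - harmExt m b y)) :=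
          Finset.sum_congr rfl fun y _ => by simp only [Pi.add_apply]; ring
      _ = 0 := by rw [Finset.sum_add_distrib, ea, eb, add_zero]

open Classical in
lemma cond_value (m : ℕ) (i : Fin 3) (a b : ℝ × ℝ) (hx : xmid i ∈ V m)
    (ha : Nbr (m + 1) (xmid i) a) (hb : Nbr (m + 1) (xmid i) b) (hab : a ≠ b) :
    cond (m + 1) (V (m + 1) \ V m) a b =
      (5 / 3 : ℝ) ^ (m + 1) * ((if Nbr (m + 1) a b then 1 else 0) + 1 / 4) := by
  have haV := Nbr_not_V hx ha
  have hbV := Nbr_not_V hx hb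
  rw [cond_eq m a b haV hbV (Nbr_V_left hb.symm') hab]
  congr 1
  have key : ∀ y ∈ nb (m + 1) b, harmExt m a y =
      (if y = a then 1 else 0) + (if y = xmid i then 1 / 4 else 0) := by
    intro y hy
    have hby := mem_nb.1 hy
    by_cases hyx : y = xmid i
    · have : xmid i ≠ a := ha.1
      rw [hyx, if_neg this, if_pos rfl, harmExt, if_pos hx, if_pos ha, nb_xmid_card]
      norm_num
    · rw [if_neg hyx, add_zero, harmExt]
      by_cases hyV : y ∈ V m
      · have hya : y ≠ a := fun h => haV (h ▸ hyV)
        rw [if_pos hyV, if_neg hya, if_neg]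
        intro hya'
        exact hyx (common_nbr hx hyV hab ha hb hya'.symm' hby)
      · rw [if_neg hyV]; rfl
  rw [Finset.sum_congr rfl key, Finset.sum_add_distrib, Finset.sum_ite_eq', Finset.sum_ite_eq',
    if_pos (mem_nb.2 hb.symm')]
  congr 1
  refine if_congr ?_ rfl rfl
  rw [mem_nb]
  exact ⟨fun h => h.symm', fun h => h.symm'⟩

/-- For `n ≥ 2` and distinct `a, b ∈ D^i_n`, with conductances of
`V_n \ V_{n−1}` computed at level `n`: if `a ∼_n b` then `c^n_{a,b} = (5/4)(5/3)^n`, and if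
the graph distance of `a` and `b` in `Γ_n` is `2` then `c^n_{a,b} = (1/4)(5/3)^n`. -/
theorem stmt8 (n : ℕ) (hn : 2 ≤ n) (i : Fin 3) (a b : ℝ × ℝ)
    (ha : a ∈ Dset n i) (hb : b ∈ Dset n i) (hab : a ≠ b) :
    (Nbr n a b → cond n (V n \ V (n - 1)) a b = 5 / 4 * (5 / 3 : ℝ) ^ n) ∧
    ((¬ Nbr n a b ∧ ∃ z : ℝ × ℝ, Nbr n a z ∧ Nbr n z b) →
      cond n (V n \ V (n - 1)) a b = 1 / 4 * (5 / 3 : ℝ) ^ n) := by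
  obtain ⟨m, rfl⟩ : ∃ m, n = m + 2 := ⟨n - 2, by omega⟩
  have e : m + 2 - 1 = m + 1 := rfl
  rw [e]
  have hc := cond_value (m + 1) i a b (xmid_V i m) ha.2.symm' hb.2.symm' hab
  constructor
  · intro h
    rw [hc, if_pos h]; ring
  · rintro ⟨h, -⟩
    rw [hc, if_neg h]; ring

end SGPaper
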